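/- arXiv:1803.02975 — 2 statements merged into one kernel-verified Lean document; each statement's English description precedes it below -/
import Mathlib

section
/- Let γ ∈ ℝ, t₁ > 0, let A : [0, t₁] → ℝ^{n×n}, and let y : [0, t₁] → ℝⁿ be differentiable with ẏ(t) = A(t)·y(t) for all t ∈ [0, t₁]. If for every t ∈ [0, t₁] every eigenvalue of the symmetric matrix (A(t)ᵀ + A(t))/2 is at most γ, then ‖y(t)‖ ≤ ‖y(0)‖·e^{γt} for all t ∈ [0, t₁], where ‖·‖ is the Euclidean (l²) norm. -/
open Matrix

/-- The Euclidean (l²) norm on `ℝⁿ`. -/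
noncomputable def euclNorm {n : ℕ} (v : Fin n → ℝ) : ℝ :=
  Real.sqrt (∑ i, v i ^ 2)

/-- Quadratic form bound from the eigenvalue bound. -/
theorem quad_form_le {n : ℕ} (γ : ℝ) (M : Matrix (Fin n) (Fin n) ℝ)
    (h : ∀ μ : ℝ, Module.End.HasEigenvalue (Matrix.toLin' ((2⁻¹ : ℝ) • (Mᵀ + M))) μ → μ ≤ γ)
    (x : Fin n → ℝ) : x ⬝ᵥ (M *ᵥ x) ≤ γ * (x ⬝ᵥ x) := by
  have hB : (γ • (1 : Matrix (Fin n) (Fin n) ℝ) - (2⁻¹ : ℝ) • (Mᵀ + M)).IsHermitian := by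
    ext i j
    simp [Matrix.one_apply, eq_comm, add_comm]
  have hpos : (γ • (1 : Matrix (Fin n) (Fin n) ℝ) - (2⁻¹ : ℝ) • (Mᵀ + M)).PosSemidef := by
    rw [hB.posSemidef_iff_eigenvalues_nonneg]
    intro i
    have hv := hB.mulVec_eigenvectorBasis i
    have hne : (hB.eigenvectorBasis i).ofLp ≠ 0 := by
      intro h0
      have h1 := hB.eigenvectorBasis.orthonormal.ne_zero i
      exact h1 (by ext j; simpa using congrFun h0 j)
    generalize (hB.eigenvectorBasis i).ofLp = v at hv hne
    have := h (γ - hB.eigenvalues i) (Module.End.hasEigenvalue_of_hasEigenvector (x := v)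
      (Module.End.hasEigenvector_iff.2 ⟨Module.End.mem_eigenspace_iff.2 (by
        rw [Matrix.sub_mulVec, Matrix.smul_mulVec, Matrix.one_mulVec] at hv
        rw [Matrix.toLin'_apply, sub_smul, ← hv]
        abel), hne⟩))
    show 0 ≤ hB.eigenvalues i
    linarith
  have hq := hpos.re_dotProduct_nonneg x
  have ht : x ⬝ᵥ (Mᵀ *ᵥ x) = x ⬝ᵥ (M *ᵥ x) := by
    rw [Matrix.mulVec_transpose, dotProduct_comm, Matrix.dotProduct_mulVec]
  simp only [star_trivial, RCLike.re_to_real, Matrix.sub_mulVec, Matrix.smul_mulVec,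
    Matrix.one_mulVec, Matrix.add_mulVec, dotProduct_sub, dotProduct_smul, dotProduct_add,
    smul_eq_mul, ht] at hq
  linarith

/-- If `y : [0,t₁] → ℝⁿ` is differentiable with
`ẏ(t) = A(t)·y(t)` on `[0,t₁]`, and for every `t ∈ [0,t₁]` every eigenvalue of the
symmetric matrix `(A(t)ᵀ + A(t))/2` is at most `γ`, then
`‖y(t)‖ ≤ ‖y(0)‖·e^{γt}` for all `t ∈ [0,t₁]` (Euclidean norm). -/
theorem exp_bound_of_eigenvalue_bound
    {n : ℕ} (γ t₁ : ℝ) (ht₁ : 0 < t₁)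
    (A : ℝ → Matrix (Fin n) (Fin n) ℝ)
    (y : ℝ → (Fin n → ℝ))
    (hy : ∀ t ∈ Set.Icc (0:ℝ) t₁, HasDerivAt y ((A t).mulVec (y t)) t)
    (heig : ∀ t ∈ Set.Icc (0:ℝ) t₁, ∀ μ : ℝ,
      Module.End.HasEigenvalue (Matrix.toLin' ((2⁻¹ : ℝ) • ((A t)ᵀ + A t))) μ → μ ≤ γ) :
    ∀ t ∈ Set.Icc (0:ℝ) t₁, euclNorm (y t) ≤ euclNorm (y 0) * Real.exp (γ * t) := by
  have hd : ∀ t ∈ Set.Icc (0:ℝ) t₁, HasDerivAt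
      (fun s => (∑ i, y s i ^ 2) * Real.exp (-(2 * γ) * s))
      (2 * (y t ⬝ᵥ (A t *ᵥ y t) - γ * (y t ⬝ᵥ y t)) * Real.exp (-(2 * γ) * t)) t := by
    intro t ht
    have h1 : HasDerivAt (fun s => ∑ i, y s i ^ 2) (∑ i, 2 * (y t i * (A t *ᵥ y t) i)) t := by
      apply HasDerivAt.fun_sum
      intro i _
      have := (hasDerivAt_pi.1 (hy t ht) i).pow 2
      refine this.congr_deriv ?_
      push_cast
      ring
    have h2 : HasDerivAt (fun s => Real.exp (-(2 * γ) * s))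
        (Real.exp (-(2 * γ) * t) * (-(2 * γ) * 1)) t :=
      ((hasDerivAt_id t).const_mul (-(2 * γ))).exp
    refine (h1.mul h2).congr_deriv ?_
    have e : ∑ i, y t i ^ 2 = y t ⬝ᵥ y t := by simp [dotProduct, sq]
    have e2 : ∑ i, 2 * (y t i * (A t *ᵥ y t) i) = 2 * (y t ⬝ᵥ (A t *ᵥ y t)) := by
      rw [← Finset.mul_sum]; rfl
    rw [e, e2]
    ring
  have hanti : AntitoneOn (fun s => (∑ i, y s i ^ 2) * Real.exp (-(2 * γ) * s))
      (Set.Icc 0 t₁) := by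
    apply antitoneOn_of_deriv_nonpos (convex_Icc _ _)
    · exact fun t ht => (hd t ht).continuousAt.continuousWithinAt
    · exact fun t ht => (hd t (interior_subset ht)).differentiableAt.differentiableWithinAt
    · intro t ht
      have ht' := interior_subset ht
      rw [(hd t ht').deriv]
      have := quad_form_le γ (A t) (heig t ht') (y t)
      exact mul_nonpos_of_nonpos_of_nonneg (by linarith) (Real.exp_pos _).le
  intro t ht
  have key := hanti (Set.left_mem_Icc.2 ht₁.le) ht ht.1
  simp only [mul_zero, Real.exp_zero, mul_one] at key
  unfold euclNorm
  rw [← Real.sqrt_sq (Real.exp_pos (γ * t)).le, ← Real.sqrt_mul (Finset.sum_nonneg fun i _ => sq_nonneg _)]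
  apply Real.sqrt_le_sqrt
  have he : Real.exp (-(2 * γ) * t) * Real.exp (γ * t) ^ 2 = 1 := by
    rw [sq, ← Real.exp_add, ← Real.exp_add, Real.exp_eq_one_iff]
    ring
  calc ∑ i, y t i ^ 2
      = (∑ i, y t i ^ 2) * Real.exp (-(2 * γ) * t) * Real.exp (γ * t) ^ 2 := by
        rw [mul_assoc, he, mul_one]
    _ ≤ _ := mul_le_mul_of_nonneg_right key (sq_nonneg _)
end

section
/- Consider the system ẋ(t) = f(x(t), u(t)) with f : ℝⁿ × ℝᵐ → ℝⁿ continuously differentiable and a fixed integrable input signal u : [0,∞) → 𝒰 ⊆ ℝᵐ with 𝒰 compact; let ξ_u(x₀, t) denote the solution with initial state x₀ and J_x the Jacobian of f with respect to the state. Suppose there is a compact convex set S ⊆ ℝⁿ, a compact initial set Θ ⊆ ℝⁿ, and a time t₁ > 0 such that ξ_u(x, t) ∈ S for all x ∈ Θ and t ∈ [0, t₁]; let [A̲, Ā] be an interval matrix with J_x(z, v) ∈ [A̲, Ā] for all z ∈ S, v ∈ 𝒰; and suppose there exists γ ∈ ℝ such that for every A ∈ [A̲, Ā], every eigenvalue of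 (Aᵀ + A)/2 is at most γ. Then for any x, x' ∈ Θ and any t ∈ [0, t₁], ‖ξ_u(x, t) − ξ_u(x', t)‖ ≤ ‖x − x'‖·e^{γt}, where ‖·‖ is the Euclidean (l²) norm. -/
open Matrix MeasureTheory

theorem rayleigh_le {n : ℕ} (B : Matrix (Fin n) (Fin n) ℝ) (hB : B.IsHermitian) (γ : ℝ)
    (h : ∀ μ : ℝ, Module.End.HasEigenvalue (Matrix.toLin' B) μ → μ ≤ γ) (v : Fin n → ℝ) :
    v ⬝ᵥ (B *ᵥ v) ≤ γ * (v ⬝ᵥ v) := by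
  have hM : (γ • (1 : Matrix (Fin n) (Fin n) ℝ) - B).IsHermitian := by
    apply Matrix.IsHermitian.sub _ hB
    simp [Matrix.IsHermitian]
  have hp : (γ • (1 : Matrix (Fin n) (Fin n) ℝ) - B).PosSemidef := by
    rw [hM.posSemidef_iff_eigenvalues_nonneg]
    intro i
    have h1 := hM.mulVec_eigenvectorBasis i
    have h2 : (hM.eigenvectorBasis i : Fin n → ℝ) ≠ 0 := by
      intro h0
      apply hM.eigenvectorBasis.orthonormal.ne_zero i
      ext j
      exact congrFun h0 j
    have h3 := h (γ - hM.eigenvalues i) (by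
      apply Module.End.hasEigenvalue_of_hasEigenvector (x := (hM.eigenvectorBasis i : Fin n → ℝ))
      refine ⟨?_, h2⟩
      rw [Module.End.mem_eigenspace_iff, Matrix.toLin'_apply, sub_smul, ← h1,
        Matrix.sub_mulVec, Matrix.smul_mulVec, Matrix.one_mulVec]
      abel)
    simp only [Pi.zero_apply]
    linarith
  have h4 := hp.dotProduct_mulVec_nonneg v
  simp only [star_trivial, Matrix.sub_mulVec, Matrix.smul_mulVec, Matrix.one_mulVec,
    dotProduct_sub, dotProduct_smul, smul_eq_mul] at h4
  linarith

theorem quad_le {n : ℕ} (A : Matrix (Fin n) (Fin n) ℝ) (γ : ℝ)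
    (h : ∀ μ : ℝ, Module.End.HasEigenvalue (Matrix.toLin' ((2⁻¹ : ℝ) • (Aᵀ + A))) μ → μ ≤ γ)
    (v : Fin n → ℝ) : v ⬝ᵥ (A *ᵥ v) ≤ γ * (v ⬝ᵥ v) := by
  have h1 := rayleigh_le _ (by
    rw [Matrix.IsHermitian, Matrix.conjTranspose_eq_transpose_of_trivial]
    simp [add_comm]) γ h v
  have h2 : v ⬝ᵥ (Aᵀ *ᵥ v) = v ⬝ᵥ (A *ᵥ v) := by
    rw [Matrix.mulVec_transpose, dotProduct_comm, ← Matrix.dotProduct_mulVec]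
  rw [Matrix.smul_mulVec, Matrix.add_mulVec, dotProduct_smul, dotProduct_add, h2, smul_eq_mul] at h1
  linarith

theorem onesided {n : ℕ} (F : (Fin n → ℝ) → (Fin n → ℝ)) (hF : Differentiable ℝ F)
    (S : Set (Fin n → ℝ)) (hS : Convex ℝ S) (γ : ℝ)
    (h : ∀ z ∈ S, ∀ v, v ⬝ᵥ (fderiv ℝ F z v) ≤ γ * (v ⬝ᵥ v))
    (a b : Fin n → ℝ) (ha : a ∈ S) (hb : b ∈ S) :
    (a - b) ⬝ᵥ (F a - F b) ≤ γ * ((a - b) ⬝ᵥ (a - b)) := by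
  have hd : ∀ s : ℝ, HasDerivAt (fun s : ℝ => (a - b) ⬝ᵥ F (b + s • (a - b)))
      ((a - b) ⬝ᵥ fderiv ℝ F (b + s • (a - b)) (a - b)) s := by
    intro s
    have h1 : HasDerivAt (fun s : ℝ => b + s • (a - b)) (a - b) s := by
      simpa using ((hasDerivAt_id s).smul_const (a - b)).const_add b
    have h2 := (hF (b + s • (a - b))).hasFDerivAt.comp_hasDerivAt s h1
    rw [hasDerivAt_pi] at h2
    exact HasDerivAt.fun_sum fun i _ => (h2 i).const_mul ((a - b) i)
  obtain ⟨c, hc, hc'⟩ := exists_hasDerivAt_eq_slope _ _ (zero_lt_one' ℝ)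
    (fun s _ => (hd s).continuousAt.continuousWithinAt) (fun s _ => hd s)
  have hz : b + c • (a - b) ∈ S := hS.add_smul_sub_mem hb ha ⟨hc.1.le, hc.2.le⟩
  have := h _ hz (a - b)
  rw [hc'] at this
  simpa [dotProduct_sub] using this

/-- Theorem 4 of the paper.
Consider `ẋ = f(x, u(t))` with `f` continuously differentiable and a fixed integrable
input `u` into a compact set `𝒰`; let `ξ x₀ t` be the solution from `x₀` and `Jx` the
state-Jacobian of `f`.  Suppose there is a compact convex set `S`, a compact initial
set `Θ`, and `t₁ > 0` with `ξ x t ∈ S` for all `x ∈ Θ`, `t ∈ [0,t₁]`; let `[A̲, Ā]`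
be an interval matrix containing `Jx(z,v)` for all `z ∈ S, v ∈ 𝒰`, and suppose
`γ ∈ ℝ` is such that every eigenvalue of `(Aᵀ + A)/2` is at most `γ` for every
`A ∈ [A̲, Ā]`.  Then for any `x, x' ∈ Θ` and `t ∈ [0,t₁]`,
`‖ξ x t − ξ x' t‖ ≤ ‖x − x'‖·e^{γt}` (Euclidean norm). -/
theorem discrepancy_exp_bound
    {n m : ℕ}
    (f : (Fin n → ℝ) → (Fin m → ℝ) → (Fin n → ℝ))
    (hf : ContDiff ℝ 1 (fun p : (Fin n → ℝ) × (Fin m → ℝ) => f p.1 p.2))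
    (U : Set (Fin m → ℝ)) (hU : IsCompact U)
    (u : ℝ → (Fin m → ℝ))
    (hu_range : ∀ t, 0 ≤ t → u t ∈ U)
    (hu_int : LocallyIntegrable u volume)
    (ξ : (Fin n → ℝ) → ℝ → (Fin n → ℝ))
    (hξ_init : ∀ x₀, ξ x₀ 0 = x₀)
    (hξ_ode : ∀ x₀ t, 0 ≤ t → HasDerivAt (ξ x₀) (f (ξ x₀ t) (u t)) t)
    (Jx : (Fin n → ℝ) → (Fin m → ℝ) → Matrix (Fin n) (Fin n) ℝ)
    (hJx : ∀ x v i j, Jx x v i j = fderiv ℝ (fun y => f y v i) x (Pi.single j 1))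
    (S : Set (Fin n → ℝ)) (hS_compact : IsCompact S) (hS_convex : Convex ℝ S)
    (Θ : Set (Fin n → ℝ)) (hΘ : IsCompact Θ)
    (t₁ : ℝ) (ht₁ : 0 < t₁)
    (hΘS : ∀ x ∈ Θ, ∀ t ∈ Set.Icc (0:ℝ) t₁, ξ x t ∈ S)
    (Alo Ahi : Matrix (Fin n) (Fin n) ℝ)
    (hA : ∀ i j, Alo i j ≤ Ahi i j)
    (hbound : ∀ z ∈ S, ∀ v ∈ U, ∀ i j, Alo i j ≤ Jx z v i j ∧ Jx z v i j ≤ Ahi i j)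
    (γ : ℝ)
    (hγ : ∀ A : Matrix (Fin n) (Fin n) ℝ,
      (∀ i j, Alo i j ≤ A i j ∧ A i j ≤ Ahi i j) →
      ∀ μ : ℝ, Module.End.HasEigenvalue (Matrix.toLin' ((2⁻¹ : ℝ) • (Aᵀ + A))) μ → μ ≤ γ) :
    ∀ x ∈ Θ, ∀ x' ∈ Θ, ∀ t ∈ Set.Icc (0:ℝ) t₁,
      euclNorm (ξ x t - ξ x' t) ≤ euclNorm (x - x') * Real.exp (γ * t) := by
  intro x hx x' hx' t ht
  have hdiff : ∀ v, Differentiable ℝ (fun y => f y v) := fun v =>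
    (hf.differentiable (by norm_num)).comp
      (differentiable_id.prodMk (differentiable_const v))
  have hJ : ∀ z v w, fderiv ℝ (fun y => f y v) z w = Jx z v *ᵥ w := by
    intro z v w
    have h0 : ∀ i, fderiv ℝ (fun y => f y v i) z w = fderiv ℝ (fun y => f y v) z w i := by
      intro i
      have := (hasFDerivAt_pi'.1 (hdiff v z).hasFDerivAt i).fderiv
      rw [this]
      rfl
    ext i
    rw [← h0 i, Matrix.mulVec, dotProduct]
    conv_lhs => rw [pi_eq_sum_univ' w, map_sum]
    refine Finset.sum_congr rfl fun j _ => ?_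
    rw [map_smul, hJx, smul_eq_mul, mul_comm]
  have key : ∀ s ∈ Set.Icc (0:ℝ) t₁,
      (ξ x s - ξ x' s) ⬝ᵥ (f (ξ x s) (u s) - f (ξ x' s) (u s))
        ≤ γ * ((ξ x s - ξ x' s) ⬝ᵥ (ξ x s - ξ x' s)) := by
    intro s hs
    refine onesided (fun y => f y (u s)) (hdiff _) S hS_convex γ ?_ _ _
      (hΘS x hx s hs) (hΘS x' hx' s hs)
    intro z hz v
    rw [hJ]
    exact quad_le _ γ (hγ _ (hbound z hz _ (hu_range s hs.1))) v
  have hg : ∀ s, 0 ≤ s → HasDerivAt (fun s => (∑ i, (ξ x s - ξ x' s) i ^ 2) * Real.exp (-(2 * γ) * s))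
      ((2 * ((ξ x s - ξ x' s) ⬝ᵥ (f (ξ x s) (u s) - f (ξ x' s) (u s)))
        - 2 * γ * ((ξ x s - ξ x' s) ⬝ᵥ (ξ x s - ξ x' s))) * Real.exp (-(2 * γ) * s)) s := by
    intro s hs
    have h1 := hasDerivAt_pi.1 ((hξ_ode x s hs).sub (hξ_ode x' s hs))
    have h2 := HasDerivAt.fun_sum (u := Finset.univ) fun i _ => (h1 i).pow 2
    have h3 := ((hasDerivAt_id s).const_mul (-(2 * γ))).exp
    refine HasDerivAt.congr_deriv (h2.mul h3) ?_
    symm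
    simp only [dotProduct, Finset.mul_sum, id, sub_mul, Finset.sum_mul, Pi.sub_apply, Pi.pow_apply]
    rw [sub_eq_add_neg, ← Finset.sum_neg_distrib]
    congr 1 <;> refine Finset.sum_congr rfl fun i _ => ?_
    · push_cast; ring
    · ring
  have hanti := antitoneOn_of_deriv_nonpos (convex_Icc (0:ℝ) t₁)
    (f := fun s => (∑ i, (ξ x s - ξ x' s) i ^ 2) * Real.exp (-(2 * γ) * s))
    (fun s hs => (hg s hs.1).continuousAt.continuousWithinAt)
    (fun s hs => (hg s (interior_subset hs).1).differentiableAt.differentiableWithinAt)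
    (fun s hs => by
      rw [(hg s (interior_subset hs).1).deriv]
      have := key s (interior_subset hs)
      exact mul_nonpos_of_nonpos_of_nonneg (by linarith) (Real.exp_pos _).le)
  have h5 := hanti ⟨le_rfl, ht₁.le⟩ ht ht.1
  simp only [hξ_init, mul_zero, Real.exp_zero, mul_one] at h5
  have h6 : (∑ i, (ξ x t - ξ x' t) i ^ 2) ≤ (∑ i, (x - x') i ^ 2) * Real.exp (γ * t) ^ 2 := by
    have he : Real.exp (-(2 * γ) * t) * Real.exp (γ * t) ^ 2 = 1 := by
      rw [sq, ← Real.exp_add, ← Real.exp_add, ← Real.exp_zero]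
      congr 1; ring
    calc _ = ((∑ i, (ξ x t - ξ x' t) i ^ 2) * Real.exp (-(2 * γ) * t)) * Real.exp (γ * t) ^ 2 := by
          rw [mul_assoc, he, mul_one]
      _ ≤ _ := mul_le_mul_of_nonneg_right h5 (sq_nonneg _)
  unfold euclNorm
  refine (Real.sqrt_le_sqrt h6).trans ?_
  rw [Real.sqrt_mul (Finset.sum_nonneg fun i _ => sq_nonneg _), Real.sqrt_sq (Real.exp_pos _).le]
end
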